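/- arXiv:math-ph/0406001 — 2 statements merged into one kernel-verified Lean document; each statement's English description precedes it below -/
import Mathlib

section
/- Let Ai(x)=(1/π)∫₀^∞cos(t³/3+xt)dt be the Airy function (which is smooth, bounded, and satisfies Ai''(x)=xAi(x)). For ω<0 define B(y,ω) = −∫₀^∞ e^{ωλ} Ai(y+λ) dλ + e^{ω³/3−yω}. Then B is smooth in (y,ω) and satisfies the same two identities as in the ω>0 case: (i) ∂_y B(y,ω) = Ai(y) − ω B(y,ω), and (ii) ∂_ω B(y,ω) = Ai'(y) − ω Ai(y) + (ω²−y) B(y,ω). -/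
noncomputable section
open MeasureTheory Real Filter Topology Set

/-- Improper Riemann-type integral over `(0, ∞)`: the limit of `∫_0^T f` as `T → ∞`. -/
def iInt (f : ℝ → ℝ) : ℝ := limUnder atTop fun T : ℝ => ∫ t in (0:ℝ)..T, f t

/-- The Airy function `Ai(x) = (1/π) ∫_0^∞ cos(t³/3 + x t) dt`. -/
def Airy (x : ℝ) : ℝ := (1 / Real.pi) * iInt fun t => Real.cos (t ^ 3 / 3 + x * t)


/-- `B(y,ω) = -∫_0^∞ e^{ωλ} Ai(y+λ) dλ + e^{ω³/3 - yω}` for `ω < 0`. -/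
def Bneg (y ω : ℝ) : ℝ :=
  -(∫ l in Set.Ioi (0:ℝ), Real.exp (ω * l) * Airy (y + l)) + Real.exp (ω ^ 3 / 3 - y * ω)

/-- The entire function `z ↦ ∫_0^∞ s^n exp(-s³/3 + z s) ds`. -/
def cubicMoment (n : ℕ) (z : ℂ) : ℂ :=
  ∫ s in Ioi (0:ℝ), (s:ℂ) ^ n * Complex.exp (-(s:ℂ) ^ 3 / 3 + z * s)

lemma integrableOn_pow_mul_exp_cubic (n : ℕ) (r : ℝ) :
    IntegrableOn (fun s : ℝ => s ^ n * exp (-s ^ 3 / 3 + r * s)) (Ioi 0) := by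
  have h0 : IntegrableOn (fun s : ℝ => s ^ n * exp (-s)) (Ioi 0) := by
    have := integrableOn_rpow_mul_exp_neg_rpow (p := 1) (s := n)
      (by have : (0:ℝ) ≤ n := n.cast_nonneg
          linarith) one_pos
    simpa using this
  refine (h0.mul_const (exp (2 / 3 * (|r| + 1) ^ 3))).mono'
    (by fun_prop) ((ae_restrict_mem measurableSet_Ioi).mono fun s hs => ?_)
  have hs : 0 < s := hs
  rw [Real.norm_of_nonneg (by positivity), mul_assoc, ← exp_add]
  refine mul_le_mul_of_nonneg_left (exp_le_exp.2 ?_) (by positivity)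
  have hq : 0 ≤ |r| := abs_nonneg r
  have hr : r ≤ |r| := le_abs_self r
  have h1 : 0 ≤ (s - (|r| + 1)) ^ 2 * (s + 2 * (|r| + 1)) := by positivity
  have h2 : r * s ≤ |r| * s := by gcongr
  have h3 : 0 ≤ |r| ^ 2 * s := by positivity
  nlinarith

lemma norm_cubicMoment_integrand_le (n : ℕ) {z : ℂ} {r s : ℝ} (hz : z.re ≤ r) (hs : 0 < s) :
    ‖(s:ℂ) ^ n * Complex.exp (-(s:ℂ) ^ 3 / 3 + z * s)‖ ≤ s ^ n * exp (-s ^ 3 / 3 + r * s) := by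
  rw [norm_mul, norm_pow, Complex.norm_real, Real.norm_of_nonneg hs.le, Complex.norm_exp]
  have : (-(s:ℂ) ^ 3 / 3 + z * s).re = -s ^ 3 / 3 + z.re * s := by
    have : (-(s:ℂ) ^ 3 / 3 : ℂ) = ((-s ^ 3 / 3 : ℝ) : ℂ) := by push_cast; ring
    rw [this, Complex.add_re, Complex.ofReal_re, Complex.re_mul_ofReal]
  rw [this]
  gcongr

lemma integrableOn_cubicMoment_integrand (n : ℕ) (z : ℂ) :
    IntegrableOn (fun s : ℝ => (s:ℂ) ^ n * Complex.exp (-(s:ℂ) ^ 3 / 3 + z * s)) (Ioi 0) :=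
  (integrableOn_pow_mul_exp_cubic n z.re).mono' (by fun_prop)
    ((ae_restrict_mem measurableSet_Ioi).mono fun _ hs =>
      norm_cubicMoment_integrand_le n le_rfl hs)

lemma norm_cubicMoment_le (n : ℕ) {z : ℂ} {r : ℝ} (hz : z.re ≤ r) :
    ‖cubicMoment n z‖ ≤ ∫ s in Ioi (0:ℝ), s ^ n * exp (-s ^ 3 / 3 + r * s) :=
  norm_integral_le_of_norm_le (integrableOn_pow_mul_exp_cubic n r)
    ((ae_restrict_mem measurableSet_Ioi).mono fun _ hs => norm_cubicMoment_integrand_le n hz hs)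

lemma hasDerivAt_cubicMoment (n : ℕ) (z : ℂ) :
    HasDerivAt (cubicMoment n) (cubicMoment (n + 1) z) z := by
  refine (hasDerivAt_integral_of_dominated_loc_of_deriv_le (s := Metric.ball z 1)
    (F := fun (z : ℂ) (s : ℝ) => (s:ℂ) ^ n * Complex.exp (-(s:ℂ) ^ 3 / 3 + z * s))
    (F' := fun (z : ℂ) (s : ℝ) => (s:ℂ) ^ (n + 1) * Complex.exp (-(s:ℂ) ^ 3 / 3 + z * s))
    (Metric.ball_mem_nhds z one_pos) (Eventually.of_forall fun w => by fun_prop)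
    (integrableOn_cubicMoment_integrand n z) (by fun_prop)
    ((ae_restrict_mem measurableSet_Ioi).mono fun s hs w hw =>
      norm_cubicMoment_integrand_le (r := z.re + 1) (n + 1) ?_ hs)
    (integrableOn_pow_mul_exp_cubic (n + 1) (z.re + 1))
    (Eventually.of_forall fun s w _ => ?_)).2
  · have h1 := (Complex.abs_re_le_norm (w - z)).trans_lt (mem_ball_iff_norm.1 hw)
    have h2 := (abs_lt.1 h1).2
    rw [Complex.sub_re] at h2
    linarith
  · have h := ((((hasDerivAt_id w).mul_const (s:ℂ)).const_add
      (-(s:ℂ) ^ 3 / 3)).cexp).const_mul ((s:ℂ) ^ n)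
    refine h.congr_deriv ?_
    simp only [id]
    ring

lemma cubicMoment_two (z : ℂ) : cubicMoment 2 z = 1 + z * cubicMoment 0 z := by
  have hd : ∀ s : ℝ, HasDerivAt (fun s : ℝ => Complex.exp (-(s:ℂ) ^ 3 / 3 + z * s))
      (z * ((s:ℂ) ^ 0 * Complex.exp (-(s:ℂ) ^ 3 / 3 + z * s))
        - (s:ℂ) ^ 2 * Complex.exp (-(s:ℂ) ^ 3 / 3 + z * s)) s := by
    intro s
    have h : HasDerivAt (fun w : ℂ => Complex.exp (-w ^ 3 / 3 + z * w))
        (Complex.exp (-(s:ℂ) ^ 3 / 3 + z * s) * (-(3 * (s:ℂ) ^ 2) / 3 + z * 1)) (s:ℂ) := by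
      have h3 : HasDerivAt (fun w : ℂ => w ^ 3) (3 * (s:ℂ) ^ 2) (s:ℂ) := by
        simpa using hasDerivAt_pow 3 (s:ℂ)
      exact ((h3.neg.div_const 3).add ((hasDerivAt_id (s:ℂ)).const_mul z)).cexp
    refine h.comp_ofReal.congr_deriv ?_
    ring
  have hi := ((integrableOn_cubicMoment_integrand 0 z).const_mul z).sub
    (integrableOn_cubicMoment_integrand 2 z)
  have ht : Tendsto (fun s : ℝ => Complex.exp (-(s:ℂ) ^ 3 / 3 + z * s)) atTop (𝓝 0) := by
    refine tendsto_zero_of_hasDerivAt_of_integrableOn_Ioi (a := 0) (fun s _ => hd s) hi ?_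
    simpa using integrableOn_cubicMoment_integrand 0 z
  have h := integral_Ioi_of_hasDerivAt_of_tendsto' (a := 0) (fun s _ => hd s) hi ht
  rw [integral_sub ((integrableOn_cubicMoment_integrand 0 z).const_mul z)
    (integrableOn_cubicMoment_integrand 2 z), integral_const_mul] at h
  change z * cubicMoment 0 z - cubicMoment 2 z = _ at h
  simp only [Complex.ofReal_zero, mul_zero, add_zero] at h
  norm_num at h
  linear_combination -h

/-- The direction `e^{iπ/6}` along which the Airy integrand decays like `exp(-s³/3)`. -/
def airyDir : ℂ := ⟨√3 / 2, 1 / 2⟩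

lemma airyDir_pow_three : airyDir ^ 3 = Complex.I := by
  have h : √3 * √3 = 3 := Real.mul_self_sqrt (by norm_num)
  have h2 : airyDir ^ 2 = ⟨1 / 2, √3 / 2⟩ := by
    apply Complex.ext <;> simp [airyDir, pow_two] <;> linarith
  rw [pow_succ, h2]
  apply Complex.ext <;> simp [airyDir] <;> linarith

lemma re_I_mul_airyDir_mul (x : ℝ) : (Complex.I * airyDir * x).re = -x / 2 := by
  simp [airyDir]
  ring

lemma norm_vertical_integral_le {x T V : ℝ} (hT : 1 ≤ T) (hb : T ≤ 8 / 9 * T ^ 2 + x)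
    (hV0 : 0 ≤ V) (hV : 3 * V ^ 2 ≤ T ^ 2) :
    ‖∫ v in (0:ℝ)..V, Complex.exp (Complex.I * ((T + Complex.I * v) ^ 3 / 3
      + x * (T + Complex.I * v)))‖ ≤ 1 / T := by
  have hbound : ∀ v ∈ Ioc 0 V, ‖Complex.exp (Complex.I * ((T + Complex.I * v) ^ 3 / 3
      + x * (T + Complex.I * v)))‖ ≤ exp (-T * v) := by
    rintro v ⟨hv0, hvV⟩
    have hre : Complex.I * (((T:ℂ) + Complex.I * v) ^ 3 / 3 + x * (T + Complex.I * v))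
        = ((-T ^ 2 * v + v ^ 3 / 3 - x * v : ℝ) : ℂ)
          + ((T ^ 3 / 3 - T * v ^ 2 + x * T : ℝ) : ℂ) * Complex.I := by
      push_cast
      linear_combination ((T:ℂ) ^ 2 * v + T * v ^ 2 * Complex.I
        + (v:ℂ) ^ 3 / 3 * (Complex.I ^ 2 - 1) + x * v) * Complex.I_sq
    rw [hre, Complex.norm_exp, exp_le_exp, Complex.add_re, Complex.ofReal_re,
      Complex.re_ofReal_mul, Complex.I_re, mul_zero, add_zero]
    have h1 : 3 * v ^ 2 ≤ T ^ 2 := le_trans (by gcongr) hV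
    nlinarith [mul_le_mul_of_nonneg_left h1 hv0.le, mul_le_mul_of_nonneg_left hb hv0.le]
  have hT0 : 0 < T := by linarith
  calc _ ≤ ∫ v in (0:ℝ)..V, exp (-T * v) :=
        intervalIntegral.norm_integral_le_of_norm_le hV0
          (Eventually.of_forall fun v hv => hbound v hv)
          (Continuous.intervalIntegrable (by fun_prop) _ _)
    _ = (1 - exp (-T * V)) / T := by
        rw [intervalIntegral.integral_comp_mul_left (fun u => exp u) (by linarith), integral_exp]
        simp
        field_simp
        ring
    _ ≤ 1 / T := by
        gcongr
        linarith [exp_pos (-T * V)]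

lemma tendsto_integral_exp_cubic (x : ℝ) :
    Tendsto (fun T : ℝ => ∫ t in (0:ℝ)..T, Complex.exp (Complex.I * ((t:ℂ) ^ 3 / 3 + x * t)))
      atTop (𝓝 (airyDir * cubicMoment 0 (Complex.I * airyDir * x))) := by
  have hf : Differentiable ℂ fun w : ℂ => Complex.exp (Complex.I * (w ^ 3 / 3 + x * w)) := by
    fun_prop
  obtain ⟨F, hF⟩ := hf.isExactOn_univ
  replace hF := fun w : ℂ => hF w (mem_univ w)
  have hreal (T : ℝ) : ∫ t in (0:ℝ)..T, Complex.exp (Complex.I * ((t:ℂ) ^ 3 / 3 + x * t))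
      = F T - F 0 := by
    have := intervalIntegral.integral_eq_sub_of_hasDerivAt (a := 0) (b := T)
      (fun t _ => (hF (t:ℂ)).comp_ofReal) (Continuous.intervalIntegrable (by fun_prop) _ _)
    simpa using this
  have hline (p d : ℂ) (R : ℝ) : (∫ s in (0:ℝ)..R,
      Complex.exp (Complex.I * ((p + d * s) ^ 3 / 3 + x * (p + d * s)))) * d
      = F (p + d * R) - F p := by
    rw [← intervalIntegral.integral_mul_const]
    have hd (s : ℝ) : HasDerivAt (fun s : ℝ => F (p + d * s))
        (Complex.exp (Complex.I * ((p + d * s) ^ 3 / 3 + x * (p + d * s))) * d) s := by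
      have h1 : HasDerivAt (fun w : ℂ => p + d * w) d (s:ℂ) := by
        simpa using ((hasDerivAt_id (s:ℂ)).const_mul d).const_add p
      exact ((hF (p + d * s)).comp (s:ℂ) h1).comp_ofReal
    have := intervalIntegral.integral_eq_sub_of_hasDerivAt (a := 0) (b := R)
      (fun s _ => hd s) (Continuous.intervalIntegrable (by fun_prop) _ _)
    simpa using this
  have h3 : √3 * √3 = 3 := Real.mul_self_sqrt (by norm_num)
  have h3' : 0 < √3 := by positivity
  have hray : Tendsto (fun T : ℝ => F (airyDir * ((2 / √3 * T : ℝ) : ℂ)) - F 0) atTop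
      (𝓝 (airyDir * cubicMoment 0 (Complex.I * airyDir * x))) := by
    have hc := intervalIntegral_tendsto_integral_Ioi 0
      (integrableOn_cubicMoment_integrand 0 (Complex.I * airyDir * x))
      (tendsto_id.const_mul_atTop (show 0 < 2 / √3 by positivity))
    refine (hc.const_mul airyDir).congr fun T => ?_
    have h := hline 0 airyDir (2 / √3 * T)
    rw [zero_add] at h
    rw [← h, mul_comm]
    congr 1
    refine intervalIntegral.integral_congr fun s _ => ?_
    simp only [pow_zero, one_mul, zero_add]
    congr 1
    linear_combination (-(s:ℂ) ^ 3 / 3) * Complex.I_sq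
      - (Complex.I * (s:ℂ) ^ 3 / 3) * airyDir_pow_three
  have hvert : Tendsto (fun T : ℝ => F (airyDir * ((2 / √3 * T : ℝ) : ℂ)) - F T) atTop
      (𝓝 0) := by
    refine squeeze_zero_norm' ?_ (tendsto_const_nhds.div_atTop tendsto_id : Tendsto
      (fun T : ℝ => 1 / id T) atTop (𝓝 0))
    filter_upwards [eventually_ge_atTop (2 + |x|)] with T hT
    have hx := neg_abs_le x
    have hx0 := abs_nonneg x
    have hend : airyDir * ((2 / √3 * T : ℝ) : ℂ) = T + Complex.I * ((T / √3 : ℝ) : ℂ) := by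
      apply Complex.ext <;> simp [airyDir] <;> field_simp
    rw [hend, ← hline, norm_mul, Complex.norm_I, mul_one]
    refine norm_vertical_integral_le (by linarith) (by nlinarith)
      (div_nonneg (by linarith) h3'.le) (le_of_eq ?_)
    rw [div_pow, pow_two √3, h3]
    ring
  have := hray.sub hvert
  rw [sub_zero] at this
  refine this.congr fun T => ?_
  rw [hreal]
  ring

lemma airy_eq (x : ℝ) :
    Airy x = 1 / π * (airyDir * cubicMoment 0 (Complex.I * airyDir * x)).re := by
  rw [Airy, iInt]
  congr 1
  refine Tendsto.limUnder_eq ?_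
  refine ((Complex.continuous_re.tendsto _).comp (tendsto_integral_exp_cubic x)).congr fun T => ?_
  have := Complex.reCLM.intervalIntegral_comp_comm (a := 0) (b := T) (μ := volume)
    (f := fun t : ℝ => Complex.exp (Complex.I * ((t:ℂ) ^ 3 / 3 + x * t)))
    (Continuous.intervalIntegrable (by fun_prop) _ _)
  rw [Function.comp_apply, ← Complex.reCLM_apply, ← this]
  refine intervalIntegral.integral_congr fun t _ => ?_
  have : Complex.I * ((t:ℂ) ^ 3 / 3 + x * t) = ((t ^ 3 / 3 + x * t : ℝ) : ℂ) * Complex.I := by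
    push_cast
    ring
  simp only [this, Complex.reCLM_apply, Complex.exp_ofReal_mul_I_re]

lemma hasDerivAt_cubicMoment_airyDir (n : ℕ) (a : ℂ) (x : ℝ) :
    HasDerivAt (fun x : ℝ => 1 / π * (a * cubicMoment n (Complex.I * airyDir * x)).re)
      (1 / π * (a * (Complex.I * airyDir) *
        cubicMoment (n + 1) (Complex.I * airyDir * x)).re) x := by
  have h1 : HasDerivAt (fun w : ℂ => Complex.I * airyDir * w) (Complex.I * airyDir) (x:ℂ) := by
    simpa using (hasDerivAt_id (x:ℂ)).const_mul (Complex.I * airyDir)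
  have h2 := ((hasDerivAt_cubicMoment n _).comp (x:ℂ) h1).const_mul a
  refine (h2.real_of_complex.const_mul (1 / π)).congr_deriv ?_
  congr 2
  ring

lemma hasDerivAt_airy (x : ℝ) :
    HasDerivAt Airy (1 / π * (airyDir * (Complex.I * airyDir) *
      cubicMoment 1 (Complex.I * airyDir * x)).re) x := by
  rw [funext airy_eq]
  exact hasDerivAt_cubicMoment_airyDir 0 airyDir x

lemma deriv_airy : deriv Airy = fun x : ℝ => 1 / π * (airyDir * (Complex.I * airyDir) *
    cubicMoment 1 (Complex.I * airyDir * x)).re :=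
  funext fun x => (hasDerivAt_airy x).deriv

/-- The Airy differential equation. -/
lemma hasDerivAt_deriv_airy (x : ℝ) : HasDerivAt (deriv Airy) (x * Airy x) x := by
  rw [deriv_airy]
  refine (hasDerivAt_cubicMoment_airyDir 1 _ x).congr_deriv ?_
  rw [cubicMoment_two, airy_eq]
  have : airyDir * (Complex.I * airyDir) * (Complex.I * airyDir)
      * (1 + Complex.I * airyDir * x * cubicMoment 0 (Complex.I * airyDir * x))
      = -Complex.I + x * (airyDir * cubicMoment 0 (Complex.I * airyDir * x)) := by
    linear_combination (Complex.I ^ 2 + Complex.I ^ 3 * airyDir * x *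
        cubicMoment 0 (Complex.I * airyDir * x)) * airyDir_pow_three
      + (Complex.I + (Complex.I ^ 2 - 1) * airyDir * x *
        cubicMoment 0 (Complex.I * airyDir * x)) * Complex.I_sq
  rw [this, Complex.add_re, Complex.re_ofReal_mul]
  simp
  ring

lemma contDiff_airy : ContDiff ℝ (⊤ : ℕ∞) Airy := by
  have h : ContDiff ℂ (⊤ : ℕ∞) (cubicMoment 0) :=
    Differentiable.contDiff fun z => (hasDerivAt_cubicMoment 0 z).differentiableAt
  rw [funext airy_eq]
  exact contDiff_const.mul (Complex.reCLM.contDiff.comp (contDiff_const.mul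
    ((h.restrict_scalars ℝ).comp (contDiff_const.mul Complex.ofRealCLM.contDiff))))

lemma contDiff_deriv_airy : ContDiff ℝ (⊤ : ℕ∞) (deriv Airy) :=
  (contDiff_infty_iff_deriv.1 contDiff_airy).2

lemma exists_forall_ge_abs_cubicMoment_airyDir_le (n : ℕ) (a : ℂ) (y : ℝ) :
    ∃ K, ∀ x, y ≤ x → |1 / π * (a * cubicMoment n (Complex.I * airyDir * x)).re| ≤ K := by
  refine ⟨1 / π * (‖a‖ * ∫ s in Ioi (0:ℝ), s ^ n * exp (-s ^ 3 / 3 + (-y / 2) * s)),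
    fun x hx => ?_⟩
  rw [abs_mul, abs_of_pos (by positivity)]
  gcongr
  refine (Complex.abs_re_le_norm _).trans ?_
  rw [norm_mul]
  gcongr
  refine norm_cubicMoment_le n ?_
  rw [re_I_mul_airyDir_mul]
  linarith

lemma exists_forall_ge_abs_airy_le (y : ℝ) : ∃ K, ∀ x, y ≤ x → |Airy x| ≤ K := by
  rw [funext airy_eq]
  exact exists_forall_ge_abs_cubicMoment_airyDir_le 0 airyDir y

lemma exists_forall_ge_abs_deriv_airy_le (y : ℝ) : ∃ K, ∀ x, y ≤ x → |deriv Airy x| ≤ K := by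
  rw [deriv_airy]
  exact exists_forall_ge_abs_cubicMoment_airyDir_le 1 _ y

/-- The Laplace-type integral `∫_y^∞ e^{ωu} Ai(u) du`. -/
def airyTail (y ω : ℝ) : ℝ := ∫ u in Ioi y, exp (ω * u) * Airy u

lemma bneg_eq (y ω : ℝ) :
    Bneg y ω = -(exp (-(ω * y)) * airyTail y ω) + exp (ω ^ 3 / 3 - y * ω) := by
  rw [Bneg, airyTail, ← integral_const_mul]
  have h := (measurePreserving_add_left volume y).setIntegral_preimage_emb
    (measurableEmbedding_addLeft y) (fun u => exp (-(ω * y)) * (exp (ω * u) * Airy u)) (Ioi y)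
  simp only [preimage_const_add_Ioi, sub_self] at h
  rw [← h]
  congr 3
  funext l
  rw [← mul_assoc, ← exp_add]
  congr 2
  ring

lemma integrableOn_pow_mul_exp_Ioi (n : ℕ) {ω : ℝ} (hω : ω < 0) (y : ℝ) :
    IntegrableOn (fun u : ℝ => u ^ n * exp (ω * u)) (Ioi y) := by
  have h0 : IntegrableOn (fun u : ℝ => u ^ n * exp (ω * u)) (Ioi 0) := by
    have := integrableOn_rpow_mul_exp_neg_mul_rpow (p := 1) (s := n) (b := -ω)
      (by have : (0:ℝ) ≤ n := n.cast_nonneg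
          linarith) one_pos (by linarith)
    simpa using this
  have h1 : IntegrableOn (fun u : ℝ => u ^ n * exp (ω * u)) (Icc y 0) :=
    Continuous.integrableOn_Icc (by fun_prop)
  exact (h1.union h0).mono_set fun u hu => by
    rcases le_or_gt u 0 with h | h
    · exact Or.inl ⟨le_of_lt hu, h⟩
    · exact Or.inr h

lemma integrableOn_pow_mul_exp_mul_airy (n : ℕ) {ω : ℝ} (hω : ω < 0) (y : ℝ) :
    IntegrableOn (fun u : ℝ => u ^ n * exp (ω * u) * Airy u) (Ioi y) := by
  obtain ⟨K, hK⟩ := exists_forall_ge_abs_airy_le y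
  refine (integrableOn_pow_mul_exp_Ioi n hω y).mul_bdd (c := K)
    contDiff_airy.continuous.aestronglyMeasurable ?_
  exact (ae_restrict_mem measurableSet_Ioi).mono fun u hu => hK u (le_of_lt hu)

lemma hasDerivAt_airyTail_left {ω : ℝ} (hω : ω < 0) (y : ℝ) :
    HasDerivAt (fun y => airyTail y ω) (-(exp (ω * y) * Airy y)) y := by
  have hc : Continuous fun u => exp (ω * u) * Airy u := by
    have := contDiff_airy.continuous
    fun_prop
  have hi (y : ℝ) : IntegrableOn (fun u => exp (ω * u) * Airy u) (Ioi y) := by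
    simpa using integrableOn_pow_mul_exp_mul_airy 0 hω y
  have h : (fun y => airyTail y ω)
      = fun y => airyTail 0 ω - ∫ u in (0:ℝ)..y, exp (ω * u) * Airy u := by
    funext y
    rw [airyTail, airyTail, ← intervalIntegral.integral_Ioi_sub_Ioi' (hi 0) (hi y)]
    ring
  rw [h]
  exact (hc.integral_hasStrictDerivAt 0 y).hasDerivAt.const_sub _

lemma integral_mul_exp_mul_airy {ω : ℝ} (hω : ω < 0) (y : ℝ) :
    ∫ u in Ioi y, u * exp (ω * u) * Airy u
      = ω ^ 2 * airyTail y ω - exp (ω * y) * (deriv Airy y - ω * Airy y) := by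
  have hd (u : ℝ) : HasDerivAt (fun u => exp (ω * u) * (deriv Airy u - ω * Airy u))
      (u * exp (ω * u) * Airy u - ω ^ 2 * (exp (ω * u) * Airy u)) u := by
    have h1 : HasDerivAt (fun u => exp (ω * u)) (exp (ω * u) * ω) u := by
      simpa using ((hasDerivAt_id u).const_mul ω).exp
    have h2 : HasDerivAt Airy (deriv Airy u) u :=
      (hasDerivAt_airy u).differentiableAt.hasDerivAt
    refine (h1.mul ((hasDerivAt_deriv_airy u).sub (h2.const_mul ω))).congr_deriv ?_
    simp only [Pi.sub_apply]
    ring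
  have hi0 : IntegrableOn (fun u => exp (ω * u) * Airy u) (Ioi y) := by
    simpa using integrableOn_pow_mul_exp_mul_airy 0 hω y
  have hi1 : IntegrableOn (fun u => u * exp (ω * u) * Airy u) (Ioi y) := by
    simpa using integrableOn_pow_mul_exp_mul_airy 1 hω y
  have ht : Tendsto (fun u => exp (ω * u) * (deriv Airy u - ω * Airy u)) atTop (𝓝 0) := by
    obtain ⟨K, hK⟩ := exists_forall_ge_abs_airy_le y
    obtain ⟨L, hL⟩ := exists_forall_ge_abs_deriv_airy_le y
    have he : Tendsto (fun u => exp (ω * u)) atTop (𝓝 0) :=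
      tendsto_exp_atBot.comp (tendsto_id.const_mul_atTop_of_neg hω)
    refine he.zero_mul_isBoundedUnder_le
      (isBoundedUnder_of_eventually_le (a := L + |ω| * K) ?_)
    filter_upwards [eventually_ge_atTop y] with u hu
    refine (norm_sub_le _ _).trans (add_le_add (hL u hu) ?_)
    rw [norm_mul]
    exact mul_le_mul_of_nonneg_left (hK u hu) (abs_nonneg ω)
  have h := integral_Ioi_of_hasDerivAt_of_tendsto' (a := y) (fun u _ => hd u)
    (hi1.sub (hi0.const_mul _)) ht
  rw [integral_sub hi1 (hi0.const_mul _), integral_const_mul] at h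
  rw [airyTail]
  linarith

lemma hasDerivAt_airyTail_right {ω : ℝ} (hω : ω < 0) (y : ℝ) :
    HasDerivAt (airyTail y)
      (ω ^ 2 * airyTail y ω - exp (ω * y) * (deriv Airy y - ω * Airy y)) ω := by
  rw [← integral_mul_exp_mul_airy hω]
  have hc := contDiff_airy.continuous
  obtain ⟨K, hK⟩ := exists_forall_ge_abs_airy_le y
  have hbound (u : ℝ) (w : ℝ) (hw : w ∈ Ioo (3 / 2 * ω) (ω / 2)) :
      exp (w * u) ≤ exp (3 / 2 * ω * u) + exp (ω / 2 * u) := by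
    rcases le_total 0 u with hu | hu
    · have : exp (w * u) ≤ exp (ω / 2 * u) :=
        exp_le_exp.2 (mul_le_mul_of_nonneg_right hw.2.le hu)
      linarith [exp_pos (3 / 2 * ω * u)]
    · have : exp (w * u) ≤ exp (3 / 2 * ω * u) :=
        exp_le_exp.2 (mul_le_mul_of_nonpos_right hw.1.le hu)
      linarith [exp_pos (ω / 2 * u)]
  refine (hasDerivAt_integral_of_dominated_loc_of_deriv_le
    (F := fun w u => exp (w * u) * Airy u) (F' := fun w u => u * exp (w * u) * Airy u)
    (bound := fun u => ‖u ^ 1 * exp (3 / 2 * ω * u) * Airy u‖ + ‖u ^ 1 * exp (ω / 2 * u) * Airy u‖)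
    (Ioo_mem_nhds (show 3 / 2 * ω < ω by linarith) (show ω < ω / 2 by linarith))
    (Eventually.of_forall fun w => (by fun_prop : Continuous _).aestronglyMeasurable)
    (by simpa [IntegrableOn] using integrableOn_pow_mul_exp_mul_airy 0 hω y)
    (by fun_prop : Continuous _).aestronglyMeasurable
    (Eventually.of_forall fun u w hw => ?_)
    ((integrableOn_pow_mul_exp_mul_airy 1 (by linarith) y).norm.add
      (integrableOn_pow_mul_exp_mul_airy 1 (by linarith) y).norm)
    (Eventually.of_forall fun u w _ => ?_)).2
  · simp only [norm_mul, pow_one, norm_of_nonneg (exp_nonneg _)]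
    rw [← add_mul, ← mul_add]
    gcongr
    exact hbound u w hw
  · refine ((((hasDerivAt_id w).mul_const u).exp).mul_const (Airy u)).congr_deriv ?_
    simp only [id]
    ring

lemma hasDerivAt_bneg_left {ω : ℝ} (hω : ω < 0) (y : ℝ) :
    HasDerivAt (fun y => Bneg y ω) (Airy y - ω * Bneg y ω) y := by
  simp only [bneg_eq]
  have h1 : HasDerivAt (fun y => exp (-(ω * y))) (exp (-(ω * y)) * -(ω * 1)) y :=
    ((hasDerivAt_id y).const_mul ω).neg.exp
  have h2 : HasDerivAt (fun y => exp (ω ^ 3 / 3 - y * ω))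
      (exp (ω ^ 3 / 3 - y * ω) * -(1 * ω)) y :=
    (((hasDerivAt_id y).mul_const ω).const_sub _).exp
  refine ((h1.mul (hasDerivAt_airyTail_left hω y)).neg.add h2).congr_deriv ?_
  have : exp (-(ω * y)) * exp (ω * y) = 1 := by rw [← exp_add]; simp
  linear_combination Airy y * this

lemma hasDerivAt_bneg_right {ω : ℝ} (hω : ω < 0) (y : ℝ) :
    HasDerivAt (Bneg y) (deriv Airy y - ω * Airy y + (ω ^ 2 - y) * Bneg y ω) ω := by
  rw [funext (bneg_eq y)]
  have h1 : HasDerivAt (fun ω => exp (-(ω * y))) (exp (-(ω * y)) * -(1 * y)) ω :=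
    ((hasDerivAt_id ω).mul_const y).neg.exp
  have h3 : HasDerivAt (fun ω : ℝ => ω ^ 3) (3 * ω ^ 2) ω := by
    simpa using hasDerivAt_pow 3 ω
  have h2 : HasDerivAt (fun ω => exp (ω ^ 3 / 3 - y * ω))
      (exp (ω ^ 3 / 3 - y * ω) * (3 * ω ^ 2 / 3 - y * 1)) ω :=
    ((h3.div_const 3).sub ((hasDerivAt_id ω).const_mul y)).exp
  refine ((h1.mul (hasDerivAt_airyTail_right hω y)).neg.add h2).congr_deriv ?_
  have : exp (-(ω * y)) * exp (ω * y) = 1 := by rw [← exp_add]; simp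
  linear_combination (deriv Airy y - ω * Airy y) * this

/-- If both partial derivatives of a function on an open set are smooth, so is the function. -/
lemma contDiffOn_uncurry_of_hasDerivAt {f f₁ f₂ : ℝ → ℝ → ℝ} {s : Set (ℝ × ℝ)} (hs : IsOpen s)
    (h₁ : ∀ p ∈ s, HasDerivAt (fun y => f y p.2) (f₁ p.1 p.2) p.1)
    (h₂ : ∀ p ∈ s, HasDerivAt (f p.1) (f₂ p.1 p.2) p.2)
    (c₁ : ContDiffOn ℝ (⊤ : ℕ∞) (Function.uncurry f₁) s)
    (c₂ : ContDiffOn ℝ (⊤ : ℕ∞) (Function.uncurry f₂) s) :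
    ContDiffOn ℝ (⊤ : ℕ∞) (Function.uncurry f) s := by
  let L := ContinuousLinearMap.toSpanSingletonCLE (𝕜 := ℝ) (E := ℝ)
  have hd : ∀ p ∈ s, HasFDerivAt (Function.uncurry f)
      (f₁ p.1 p.2 • ContinuousLinearMap.fst ℝ ℝ ℝ + f₂ p.1 p.2 • ContinuousLinearMap.snd ℝ ℝ ℝ)
      p := by
    intro p hp
    have hnhds := hs.mem_nhds hp
    have h := hasStrictFDerivAt_uncurry_coprod (𝕜 := ℝ) (u := p) (f := f)
      (f₁ := fun y w => ContinuousLinearMap.toSpanSingleton ℝ (f₁ y w))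
      (f₂ := fun y w => ContinuousLinearMap.toSpanSingleton ℝ (f₂ y w))
      (Filter.eventually_of_mem hnhds fun q hq => (h₁ q hq).hasFDerivAt)
      (Filter.eventually_of_mem hnhds fun q hq => (h₂ q hq).hasFDerivAt)
      (L.continuous.continuousAt.comp (c₁.continuousOn.continuousAt hnhds))
      (L.continuous.continuousAt.comp (c₂.continuousOn.continuousAt hnhds))
    refine h.hasFDerivAt.congr_fderiv ?_
    ext <;> simp [Function.HasUncurry.uncurry]
  refine (contDiffOn_infty_iff_fderiv_of_isOpen hs).2
    ⟨fun p hp => (hd p hp).differentiableAt.differentiableWithinAt, ?_⟩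
  refine ContDiffOn.congr ?_ fun p hp => (hd p hp).fderiv
  exact (c₁.smul contDiffOn_const).add (c₂.smul contDiffOn_const)

lemma contDiffOn_bneg :
    ContDiffOn ℝ (⊤ : ℕ∞) (fun p : ℝ × ℝ => Bneg p.1 p.2) (univ ×ˢ Iio (0:ℝ)) := by
  have hA := contDiff_airy
  have hA' := contDiff_deriv_airy
  have hC : ContDiffOn ℝ (⊤ : ℕ∞)
      (Function.uncurry fun y ω => exp (y * ω - ω ^ 3 / 3) * Bneg y ω) (univ ×ˢ Iio (0:ℝ)) := by
    refine contDiffOn_uncurry_of_hasDerivAt (isOpen_univ.prod isOpen_Iio)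
      (f₁ := fun y ω => exp (y * ω - ω ^ 3 / 3) * Airy y)
      (f₂ := fun y ω => exp (y * ω - ω ^ 3 / 3) * (deriv Airy y - ω * Airy y)) ?_ ?_
      (ContDiff.contDiffOn ?_) (ContDiff.contDiffOn ?_)
    · rintro ⟨y, ω⟩ ⟨-, hω⟩
      have h1 : HasDerivAt (fun y => exp (y * ω - ω ^ 3 / 3))
          (exp (y * ω - ω ^ 3 / 3) * (1 * ω)) y :=
        (((hasDerivAt_id y).mul_const ω).sub_const _).exp
      refine (h1.mul (hasDerivAt_bneg_left hω y)).congr_deriv ?_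
      ring
    · rintro ⟨y, ω⟩ ⟨-, hω⟩
      have h3 : HasDerivAt (fun ω : ℝ => ω ^ 3) (3 * ω ^ 2) ω := by
        simpa using hasDerivAt_pow 3 ω
      have h1 : HasDerivAt (fun ω => exp (y * ω - ω ^ 3 / 3))
          (exp (y * ω - ω ^ 3 / 3) * (y * 1 - 3 * ω ^ 2 / 3)) ω :=
        (((hasDerivAt_id ω).const_mul y).sub (h3.div_const 3)).exp
      refine (h1.mul (hasDerivAt_bneg_right hω y)).congr_deriv ?_
      ring
    · simp only [Function.uncurry_def]
      fun_prop
    · simp only [Function.uncurry_def]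
      fun_prop
  have hE : ContDiff ℝ (⊤ : ℕ∞) fun p : ℝ × ℝ => exp (p.2 ^ 3 / 3 - p.1 * p.2) := by fun_prop
  refine (hE.contDiffOn.mul hC).congr fun p _ => ?_
  simp only [Function.uncurry_def, ← mul_assoc, ← exp_add]
  simp

/-- For `ω < 0`, the function
`B(y,ω) = -∫_0^∞ e^{ωλ} Ai(y+λ) dλ + e^{ω³/3 - yω}` is smooth in `(y,ω)` and satisfies
the same identities `∂_y B = Ai(y) - ωB` and `∂_ω B = Ai'(y) - ωAi(y) + (ω² - y)B`
as in the `ω > 0` case. -/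
theorem Bneg_smooth_and_derivs :
    ContDiffOn ℝ (⊤ : ℕ∞) (fun pr : ℝ × ℝ => Bneg pr.1 pr.2) (Set.univ ×ˢ Set.Iio (0:ℝ)) ∧
    (∀ y ω : ℝ, ω < 0 →
      HasDerivAt (fun y' => Bneg y' ω) (Airy y - ω * Bneg y ω) y) ∧
    (∀ y ω : ℝ, ω < 0 →
      HasDerivAt (fun ω' => Bneg y ω')
        (deriv Airy y - ω * Airy y + (ω ^ 2 - y) * Bneg y ω) ω) :=
  ⟨contDiffOn_bneg, fun y _ hω => hasDerivAt_bneg_left hω y,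
    fun y _ hω => hasDerivAt_bneg_right hω y⟩

end
end

section
/- Fix s∈ℝ. Let Ai be the Airy function, and suppose Q(y) and R(y) (for y ≥ s) are differentiable functions and u, v, q are reals such that: (1) Q(y)Ai(y)→0 as y→∞, (2) Q'(y)=P(y)−uQ(y)+qR(y) for a function P with v=∫_s^∞P(y)Ai(y)dy, (3) u=∫_s^∞Q(y)Ai(y)dy, (4) q=Q(s), and (5) ∫_s^∞R(y)Ai(y)dy = q − Ai(s), where R(y)=R(s;s,y) is the resolvent kernel row at s. Then −∫_s^∞ Q(y)Ai'(y) dy = v − u² + q². -/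
noncomputable section
open MeasureTheory Real Filter Topology Set

theorem abs_integral_mul_deriv_le_of_antitone {A B : ℝ} (hAB : A ≤ B) {w w' c c' : ℝ → ℝ}
    (hw : ∀ t ∈ Icc A B, HasDerivAt w (w' t) t) (hc : ∀ t ∈ Icc A B, HasDerivAt c (c' t) t)
    (hw'c : ContinuousOn w' (Icc A B)) (hc'c : ContinuousOn c' (Icc A B))
    (hw' : ∀ t ∈ Icc A B, w' t ≤ 0) (hw0 : ∀ t ∈ Icc A B, 0 ≤ w t)
    (hc1 : ∀ t ∈ Icc A B, |c t| ≤ 1) :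
    |∫ t in A..B, w t * c' t| ≤ 2 * w A := by
  have hU : uIcc A B = Icc A B := uIcc_of_le hAB
  have hwi : IntervalIntegrable w' volume A B := by
    apply ContinuousOn.intervalIntegrable; rwa [hU]
  have hci : IntervalIntegrable c' volume A B := by
    apply ContinuousOn.intervalIntegrable; rwa [hU]
  rw [intervalIntegral.integral_mul_deriv_eq_deriv_mul (by rwa [hU]) (by rwa [hU]) hwi hci]
  have hFTC : ∫ t in A..B, -w' t = w A - w B := by
    rw [intervalIntegral.integral_neg,
      intervalIntegral.integral_eq_sub_of_hasDerivAt (by rwa [hU]) hwi]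
    ring
  have hbound : |∫ t in A..B, w' t * c t| ≤ w A - w B := by
    rw [← hFTC, ← Real.norm_eq_abs]
    refine intervalIntegral.norm_integral_le_of_norm_le hAB ?_ hwi.neg
    refine Eventually.of_forall fun t ht => ?_
    have ht' := Ioc_subset_Icc_self ht
    rw [Real.norm_eq_abs, abs_mul, abs_of_nonpos (hw' t ht')]
    exact mul_le_of_le_one_right (neg_nonneg.2 (hw' t ht')) (hc1 t ht')
  have hA := left_mem_Icc.2 hAB
  have hB := right_mem_Icc.2 hAB
  have h1 : |w B * c B| ≤ w B := by
    rw [abs_mul, abs_of_nonneg (hw0 B hB)]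
    exact mul_le_of_le_one_right (hw0 B hB) (hc1 B hB)
  have h2 : |w A * c A| ≤ w A := by
    rw [abs_mul, abs_of_nonneg (hw0 A hA)]
    exact mul_le_of_le_one_right (hw0 A hA) (hc1 A hA)
  rw [abs_le] at *
  constructor <;> linarith

theorem hasDerivAt_airy_phase (x t : ℝ) :
    HasDerivAt (fun t : ℝ => t ^ 3 / 3 + x * t) (t ^ 2 + x) t := by
  have h := ((hasDerivAt_pow 3 t).div_const 3).add ((hasDerivAt_id t).const_mul x)
  refine h.congr_deriv ?_
  norm_num

theorem half_sq_le_sq_add {M A x t : ℝ} (hM : 0 ≤ M) (hA : 2 * M + 2 ≤ A) (hx : |x| ≤ M)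
    (ht : A ≤ t) : t ^ 2 / 2 + |x| ≤ t ^ 2 + x := by
  have := neg_abs_le x
  nlinarith

theorem abs_integral_cos_airy_phase_le {M A B x : ℝ} (hM : 0 ≤ M) (hA : 2 * M + 2 ≤ A)
    (hAB : A ≤ B) (hx : |x| ≤ M) :
    |∫ t in A..B, Real.cos (t ^ 3 / 3 + x * t)| ≤ 4 / A := by
  have hpos : ∀ t ∈ Icc A B, 0 < t ^ 2 + x := fun t ht => by
    have := half_sq_le_sq_add hM hA hx ht.1
    have := abs_nonneg x
    nlinarith [ht.1]
  have hcongr : ∫ t in A..B, Real.cos (t ^ 3 / 3 + x * t) =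
      ∫ t in A..B, (t ^ 2 + x)⁻¹ * (Real.cos (t ^ 3 / 3 + x * t) * (t ^ 2 + x)) := by
    refine intervalIntegral.integral_congr fun t ht => ?_
    rw [uIcc_of_le hAB] at ht
    have := (hpos t ht).ne'
    field_simp
  rw [hcongr]
  refine (abs_integral_mul_deriv_le_of_antitone hAB
    (w' := fun t => -(2 * t) / (t ^ 2 + x) ^ 2)
    (c := fun t => Real.sin (t ^ 3 / 3 + x * t)) (fun t ht => ?_)
    (fun t _ => (hasDerivAt_airy_phase x t).sin) ?_ (by fun_prop) (fun t ht => ?_)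
    (fun t ht => (inv_pos.2 (hpos t ht)).le) fun t _ => Real.abs_sin_le_one _).trans ?_
  · have h := ((hasDerivAt_pow 2 t).add_const x).inv (hpos t ht).ne'
    exact h.congr_deriv (by norm_num)
  · exact ContinuousOn.div (by fun_prop) (by fun_prop) fun t ht => pow_ne_zero 2 (hpos t ht).ne'
  · exact div_nonpos_of_nonpos_of_nonneg (by linarith [ht.1]) (sq_nonneg _)
  · have h1 := half_sq_le_sq_add hM hA hx le_rfl
    have h2 := abs_nonneg x
    have h3 : 0 < A := by linarith
    rw [← div_eq_mul_inv, div_le_div_iff₀ (hpos A (left_mem_Icc.2 hAB)) h3]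
    nlinarith

theorem abs_integral_mul_sin_airy_phase_le {M A B x : ℝ} (hM : 0 ≤ M) (hA : 2 * M + 2 ≤ A)
    (hAB : A ≤ B) (hx : |x| ≤ M) :
    |∫ t in A..B, t * Real.sin (t ^ 3 / 3 + x * t)| ≤ 4 / A := by
  have hpos : ∀ t ∈ Icc A B, 0 < t ^ 2 + x := fun t ht => by
    have := half_sq_le_sq_add hM hA hx ht.1
    have := abs_nonneg x
    nlinarith [ht.1]
  have hcongr : ∫ t in A..B, t * Real.sin (t ^ 3 / 3 + x * t) =
      ∫ t in A..B, t / (t ^ 2 + x) * -(-Real.sin (t ^ 3 / 3 + x * t) * (t ^ 2 + x)) := by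
    refine intervalIntegral.integral_congr fun t ht => ?_
    rw [uIcc_of_le hAB] at ht
    have := (hpos t ht).ne'
    field_simp
  rw [hcongr]
  refine (abs_integral_mul_deriv_le_of_antitone hAB
    (w' := fun t => (x - t ^ 2) / (t ^ 2 + x) ^ 2)
    (c := fun t => -Real.cos (t ^ 3 / 3 + x * t)) (fun t ht => ?_)
    (fun t _ => (hasDerivAt_airy_phase x t).cos.neg) ?_ (by fun_prop) (fun t ht => ?_)
    (fun t ht => div_nonneg (by linarith [ht.1]) (hpos t ht).le) fun t _ => ?_).trans ?_
  · have h := (hasDerivAt_id t).div ((hasDerivAt_pow 2 t).add_const x) (hpos t ht).ne'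
    refine h.congr_deriv ?_
    simp only [id]
    congr 1
    norm_num
    ring
  · exact ContinuousOn.div (by fun_prop) (by fun_prop) fun t ht => pow_ne_zero 2 (hpos t ht).ne'
  · refine div_nonpos_of_nonpos_of_nonneg ?_ (sq_nonneg _)
    nlinarith [ht.1, le_abs_self x]
  · rw [abs_neg]
    exact Real.abs_cos_le_one _
  · have h1 := half_sq_le_sq_add hM hA hx le_rfl
    have h2 := abs_nonneg x
    have h3 : 0 < A := by linarith
    rw [← mul_div_assoc, div_le_div_iff₀ (hpos A (left_mem_Icc.2 hAB)) h3]
    nlinarith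

theorem uniformCauchySeqOn_integral_of_abs_le {f : ℝ → ℝ → ℝ} {S : Set ℝ} {C K : ℝ}
    (hf : ∀ x, Continuous (f x))
    (hbound : ∀ A B, K ≤ A → A ≤ B → ∀ x ∈ S, |∫ t in A..B, f x t| ≤ C / A) :
    UniformCauchySeqOn (fun (T : ℝ) x => ∫ t in (0 : ℝ)..T, f x t) atTop S := by
  rw [Metric.uniformCauchySeqOn_iff]
  intro ε hε
  have hlim : Tendsto (fun A : ℝ => C / A) atTop (𝓝 0) := tendsto_const_nhds.div_atTop tendsto_id
  have hev : ∀ᶠ A in atTop, C / A < ε := hlim.eventually_lt_const hε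
  obtain ⟨N, hN, hKN⟩ := ((eventually_forall_ge_atTop.2 hev).and (eventually_ge_atTop K)).exists
  have key : ∀ A B, N ≤ A → A ≤ B → ∀ x ∈ S,
      dist (∫ t in (0 : ℝ)..A, f x t) (∫ t in (0 : ℝ)..B, f x t) < ε := by
    intro A B hA hAB x hx
    rw [dist_comm, Real.dist_eq, intervalIntegral.integral_interval_sub_left
      ((hf x).intervalIntegrable _ _) ((hf x).intervalIntegrable _ _)]
    exact (hbound A B (hKN.trans hA) hAB x hx).trans_lt (hN A hA)
  refine ⟨N, fun A hA B hB x hx => ?_⟩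
  rcases le_total A B with h | h
  · exact key A B hA h x hx
  · rw [dist_comm]
    exact key B A hB h x hx

theorem hasDerivAt_integral_cos_airy_phase (T x : ℝ) :
    HasDerivAt (fun x => ∫ t in (0 : ℝ)..T, Real.cos (t ^ 3 / 3 + x * t))
      (∫ t in (0 : ℝ)..T, -(t * Real.sin (t ^ 3 / 3 + x * t))) x := by
  refine (intervalIntegral.hasDerivAt_integral_of_dominated_loc_of_deriv_le
    (F := fun x t => Real.cos (t ^ 3 / 3 + x * t))
    (F' := fun x t => -(t * Real.sin (t ^ 3 / 3 + x * t)))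
    (bound := fun t => |t|) univ_mem ?_ ?_ ?_ ?_ ?_ ?_).2
  · exact Eventually.of_forall fun y => Continuous.aestronglyMeasurable (by fun_prop)
  · exact Continuous.intervalIntegrable (by fun_prop) _ _
  · exact Continuous.aestronglyMeasurable (by fun_prop)
  · refine Eventually.of_forall fun t _ y _ => ?_
    rw [norm_neg, norm_mul, Real.norm_eq_abs, Real.norm_eq_abs]
    exact mul_le_of_le_one_right (abs_nonneg t) (Real.abs_sin_le_one _)
  · exact continuous_abs.intervalIntegrable _ _
  · refine Eventually.of_forall fun t _ y _ => ?_
    have h := (((hasDerivAt_id y).mul_const t).const_add (t ^ 3 / 3)).cos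
    refine h.congr_deriv ?_
    simp only [id]
    ring

theorem differentiable_Airy : Differentiable ℝ Airy := by
  intro x
  set M : ℝ := |x| + 1 with hMdef
  have hM : 0 ≤ M := by positivity
  have habs : ∀ y ∈ Ioo (-M) M, |y| ≤ M := fun y hy => (abs_lt.2 hy).le
  have hcos := uniformCauchySeqOn_integral_of_abs_le
    (f := fun x t => Real.cos (t ^ 3 / 3 + x * t)) (S := Ioo (-M) M) (C := 4) (K := 2 * M + 2)
    (fun y => by fun_prop)
    (fun A B hA hAB y hy => abs_integral_cos_airy_phase_le hM hA hAB (habs y hy))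
  have hsin := uniformCauchySeqOn_integral_of_abs_le
    (f := fun x t => -(t * Real.sin (t ^ 3 / 3 + x * t))) (S := Ioo (-M) M) (C := 4)
    (K := 2 * M + 2) (fun y => by fun_prop)
    (fun A B hA hAB y hy => by
      rw [intervalIntegral.integral_neg, abs_neg]
      exact abs_integral_mul_sin_airy_phase_le hM hA hAB (habs y hy))
  have hpt : ∀ y ∈ Ioo (-M) M,
      Tendsto (fun T : ℝ => ∫ t in (0 : ℝ)..T, Real.cos (t ^ 3 / 3 + y * t)) atTop
        (𝓝 (iInt fun t => Real.cos (t ^ 3 / 3 + y * t))) := fun y hy =>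
    tendsto_nhds_limUnder (cauchy_map_iff_exists_tendsto.1 (hcos.cauchy_map hy))
  have hlim : TendstoUniformlyOn
      (fun (T : ℝ) y => ∫ t in (0 : ℝ)..T, -(t * Real.sin (t ^ 3 / 3 + y * t)))
      (fun y => iInt fun t => -(t * Real.sin (t ^ 3 / 3 + y * t))) atTop (Ioo (-M) M) :=
    hsin.tendstoUniformlyOn_of_tendsto fun y hy =>
      tendsto_nhds_limUnder (cauchy_map_iff_exists_tendsto.1 (hsin.cauchy_map hy))
  have hx : x ∈ Ioo (-M) M := abs_lt.1 (by rw [hMdef]; linarith)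
  exact ((hasDerivAt_of_tendstoUniformlyOn isOpen_Ioo hlim
    (Eventually.of_forall fun T y _ => hasDerivAt_integral_cos_airy_phase T y)
    hpt hx).const_mul (1 / Real.pi)).differentiableAt

/-- The intermediate integration-by-parts identity
`-∫_s^∞ Q(y) Ai'(y) dy = v - u² + q²` in the proof of Proposition 4.1. -/
theorem Q_Airy_deriv_integral_identity (s : ℝ) (Q P R : ℝ → ℝ) (u v q : ℝ)
    (hQAi_vanish : Tendsto (fun y => Q y * Airy y) atTop (𝓝 0))
    (hQderiv : ∀ y, s ≤ y → HasDerivAt Q (P y - u * Q y + q * R y) y)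
    (hu : u = ∫ y in Set.Ioi s, Q y * Airy y)
    (hv : v = ∫ y in Set.Ioi s, P y * Airy y)
    (hqdef : q = Q s)
    (hRAi : (∫ y in Set.Ioi s, R y * Airy y) = q - Airy s)
    (hintQAi' : IntegrableOn (fun y => Q y * deriv Airy y) (Set.Ioi s))
    (hintQAi : IntegrableOn (fun y => Q y * Airy y) (Set.Ioi s))
    (hintPAi : IntegrableOn (fun y => P y * Airy y) (Set.Ioi s))
    (hintRAi : IntegrableOn (fun y => R y * Airy y) (Set.Ioi s)) :
    -(∫ y in Set.Ioi s, Q y * deriv Airy y) = v - u ^ 2 + q ^ 2 := by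
  have hderiv : ∀ y ∈ Ici s, HasDerivAt (fun y => Q y * Airy y)
      (P y * Airy y - u * (Q y * Airy y) + q * (R y * Airy y) + Q y * deriv Airy y) y := by
    intro y hy
    refine ((hQderiv y hy).mul (differentiable_Airy y).hasDerivAt).congr_deriv ?_
    ring
  have hPQ : IntegrableOn (fun y => P y * Airy y - u * (Q y * Airy y)) (Ioi s) :=
    hintPAi.sub (hintQAi.const_mul u)
  have hPQR : IntegrableOn (fun y => P y * Airy y - u * (Q y * Airy y) + q * (R y * Airy y))
      (Ioi s) :=
    hPQ.add (hintRAi.const_mul q)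
  have hFTC := integral_Ioi_of_hasDerivAt_of_tendsto' hderiv (hPQR.add hintQAi') hQAi_vanish
  have hsplit : ∫ y in Ioi s,
      (P y * Airy y - u * (Q y * Airy y) + q * (R y * Airy y) + Q y * deriv Airy y) =
      v - u * u + q * (q - Airy s) + ∫ y in Ioi s, Q y * deriv Airy y := by
    rw [integral_add hPQR hintQAi', integral_add hPQ (hintRAi.const_mul q),
      integral_sub hintPAi (hintQAi.const_mul u), integral_const_mul, integral_const_mul,
      hRAi, ← hu, ← hv]
  rw [hsplit, ← hqdef] at hFTC
  linarith

end
end
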